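/- arXiv:2406.19929 — 2 statements merged into one kernel-verified Lean document; each statement's English description precedes it below -/
import Mathlib

section
/- Let τ belong to class 𝒯. Then for all sufficiently large n ∈ ℕ, the iterate τ^n belongs to class 𝒯_E; that is, with 𝒫^{(n)} = {(a_i^{(n)}, b_i^{(n)})} the branch-interval partition of τ^n and g_n(x) := 1/(τ^n)'(x) on the branch intervals (g_n := 0 elsewhere), there exists β < 1 such that sup_{x∈I} g_n(x) ≤ β < 1 and the total variation of g_n on I is finite. -/
open Set Filter MeasureTheory Topology

structure PCT where
  τ : ℝ → ℝ
  a : ℕ → ℝ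
  b : ℕ → ℝ
  da : ℕ → ℝ
  maps_to : Set.MapsTo τ (Set.Icc 0 1) (Set.Icc 0 1)
  lt : ∀ i, a i < b i
  sub : ∀ i, Set.Ioo (a i) (b i) ⊆ Set.Icc (0:ℝ) 1
  disj : Pairwise (Function.onFun Disjoint fun i => Set.Ioo (a i) (b i))
  null : volume (Set.Icc (0:ℝ) 1 \ ⋃ i, Set.Ioo (a i) (b i)) = 0
  mono : ∀ i, StrictMonoOn τ (Set.Ioo (a i) (b i))
  conv : ∀ i, ConvexOn ℝ (Set.Ioo (a i) (b i)) τ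
  diff : ∀ i, ∀ x ∈ Set.Ioo (a i) (b i), DifferentiableAt ℝ τ x
  lim_zero : ∀ i, Filter.Tendsto τ (nhdsWithin (a i) (Set.Ioi (a i))) (nhds 0)
  deriv_lim : ∀ i, Filter.Tendsto (deriv τ) (nhdsWithin (a i) (Set.Ioi (a i))) (nhds (da i))
  da_pos : ∀ i, 0 < da i
  sum_inv : Summable (fun i => 1 / da i)
  expand : (¬ AccPt (0:ℝ) (Filter.principal (Set.range a))) → ∃ i, a i = 0 ∧ 1 < da i

/-- The interval `(c,d)` follows a single sequence of branches under the first `n`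
iterates of `τ`. -/
def IsBranchSeq (T : PCT) (n : ℕ) (c d : ℝ) : Prop :=
  c < d ∧ ∀ k < n, ∃ i, T.τ^[k] '' Set.Ioo c d ⊆ Set.Ioo (T.a i) (T.b i)

/-- `(c,d)` is a maximal open interval on which `τ^n` is a single monotone branch,
i.e. an element of the partition `𝒫⁽ⁿ⁾`. -/
def IsBranchInterval (T : PCT) (n : ℕ) (c d : ℝ) : Prop :=
  IsBranchSeq T n c d ∧
    ∀ c' d', c' ≤ c → d ≤ d' → IsBranchSeq T n c' d' → c' = c ∧ d' = d

/-! ### Countable sums of monotone pieces -/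

/-- A difference of two monotone real functions has bounded variation on a compact interval. -/
lemma boundedVariationOn_sub_of_monotone {p q : ℝ → ℝ} (hp : Monotone p) (hq : Monotone q)
    (u v : ℝ) : BoundedVariationOn (fun x => p x - q x) (Icc u v) := by
  have hpq : BoundedVariationOn (fun x => p x + q x) (Icc u v) := by
    refine ((hp.add hq).monotoneOn (Icc u v)).boundedVariationOn
      (C := max |p u + q u| |p v + q v|) fun x hx => ?_
    exact abs_le_max_abs_abs (add_le_add (hp hx.1) (hq hx.1)) (add_le_add (hp hx.2) (hq hx.2))
  refine ne_top_of_le_ne_top hpq (iSup_mono fun r => Finset.sum_le_sum fun i _ => ?_)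
  have h₁ := hp (r.2.2.1 (Nat.le_succ i))
  have h₂ := hq (r.2.2.1 (Nat.le_succ i))
  rw [edist_dist, edist_dist, Real.dist_eq, Real.dist_eq]
  refine ENNReal.ofReal_le_ofReal (abs_le_abs ?_ ?_) <;> simp only [Nat.succ_eq_add_one] at * <;>
    linarith

/-- A function vanishing off a disjoint union of order-connected sets `A j`, nonnegative and
antitone on each of them with summable bounds `M j`, has bounded variation. -/
lemma boundedVariationOn_indicator_iUnion {ι : Type*} {A : ι → Set ℝ} {M : ι → ℝ} {f : ℝ → ℝ}
    (hA : ∀ j, (A j).OrdConnected) (hdisj : Pairwise (Function.onFun Disjoint A))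
    (hM : Summable M) (hM0 : ∀ j, 0 ≤ M j) (hf0 : ∀ j, ∀ x ∈ A j, 0 ≤ f x)
    (hfM : ∀ j, ∀ x ∈ A j, f x ≤ M j) (hf : ∀ j, AntitoneOn f (A j)) (u v : ℝ) :
    BoundedVariationOn (indicator (⋃ j, A j) f) (Icc u v) := by
  classical
  let p : ι → ℝ → ℝ := fun j x => if ∃ z ∈ A j, z ≤ x then M j else 0
  let q : ι → ℝ → ℝ := fun j x => if x ∈ A j then M j - f x else p j x
  have hp0 : ∀ j x, 0 ≤ p j x := fun j x => by
    dsimp only [p]; split_ifs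
    exacts [hM0 j, le_rfl]
  have hpM : ∀ j x, p j x ≤ M j := fun j x => by
    dsimp only [p]; split_ifs
    exacts [le_rfl, hM0 j]
  have hq0 : ∀ j x, 0 ≤ q j x := fun j x => by
    dsimp only [q]; split_ifs with h
    exacts [sub_nonneg.2 (hfM j x h), hp0 j x]
  have hqM : ∀ j x, q j x ≤ M j := fun j x => by
    dsimp only [q]; split_ifs with h
    exacts [sub_le_self _ (hf0 j x h), hpM j x]
  have hpmono : ∀ j, Monotone (p j) := fun j x y hxy => by
    by_cases h : ∃ z ∈ A j, z ≤ x
    · have h' : ∃ z ∈ A j, z ≤ y := h.imp fun z hz => ⟨hz.1, hz.2.trans hxy⟩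
      simp only [p, if_pos h, if_pos h', le_refl]
    · simpa only [p, if_neg h] using hp0 j y
  have hqmono : ∀ j, Monotone (q j) := fun j x y hxy => by
    by_cases hx : x ∈ A j
    · by_cases hy : y ∈ A j
      · simpa only [q, if_pos hx, if_pos hy] using sub_le_sub_left (hf j hx hy hxy) (M j)
      · have h' : ∃ z ∈ A j, z ≤ y := ⟨x, hx, hxy⟩
        simpa only [q, p, if_pos hx, if_neg hy, if_pos h'] using sub_le_self _ (hf0 j x hx)
    · by_cases hy : y ∈ A j
      · have h : ¬ ∃ z ∈ A j, z ≤ x := fun ⟨z, hz, hzx⟩ => hx ((hA j).out hz hy ⟨hzx, hxy⟩)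
        simpa only [q, p, if_neg hx, if_neg h] using hq0 j y
      · simpa only [q, if_neg hx, if_neg hy] using hpmono j hxy
  have hps : ∀ x, Summable fun j => p j x := fun x =>
    hM.of_nonneg_of_le (fun j => hp0 j x) fun j => hpM j x
  have hqs : ∀ x, Summable fun j => q j x := fun x =>
    hM.of_nonneg_of_le (fun j => hq0 j x) fun j => hqM j x
  have hsum : indicator (⋃ j, A j) f = fun x => (∑' j, p j x) - ∑' j, q j x := by
    funext x
    rw [← (hps x).tsum_sub (hqs x)]
    by_cases hx : x ∈ ⋃ j, A j
    · obtain ⟨j, hj⟩ := mem_iUnion.1 hx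
      rw [indicator_of_mem hx, tsum_eq_single j]
      · have h : ∃ z ∈ A j, z ≤ x := ⟨x, hj, le_rfl⟩
        simp only [q, p, if_pos hj, if_pos h, sub_sub_cancel]
      · intro k hk
        have hxk : x ∉ A k := fun h => (hdisj hk).le_bot ⟨h, hj⟩
        simp only [q, if_neg hxk, sub_self]
    · have h : ∀ j, x ∉ A j := fun j hj => hx (mem_iUnion.2 ⟨j, hj⟩)
      rw [indicator_of_notMem hx]
      simp only [q, h, if_false, sub_self, tsum_zero]
  rw [hsum]
  exact boundedVariationOn_sub_of_monotone
    (fun x y hxy => (hps x).tsum_le_tsum (fun j => hpmono j hxy) (hps y))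
    (fun x y hxy => (hqs x).tsum_le_tsum (fun j => hqmono j hxy) (hqs y)) u v

/-- Products of a summable nonnegative family over words of fixed length are summable. -/
lemma summable_prod_words {f : ℕ → ℝ} (hf : Summable f) (hf0 : ∀ i, 0 ≤ f i) (n : ℕ) :
    Summable fun w : Fin n → ℕ => ∏ k, f (w k) := by
  induction n with
  | zero => exact Summable.of_finite
  | succ n ih =>
    rw [← (Fin.snocEquiv fun _ => ℕ).summable_iff]
    refine (hf.mul_of_nonneg ih hf0 fun w => Finset.prod_nonneg fun k _ => hf0 _).congr
      fun r => ?_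
    simp [Fin.prod_univ_castSucc, mul_comm]

/-- A nonempty bounded open order-connected set of reals is an open interval. -/
lemma exists_eq_Ioo {A : Set ℝ} (hA : A.OrdConnected) (ho : IsOpen A) (hne : A.Nonempty)
    (hb : BddBelow A) (ha : BddAbove A) : ∃ c d, A = Ioo c d := by
  refine ⟨sInf A, sSup A, Subset.antisymm ?_
    (IsConnected.Ioo_csInf_csSup_subset ⟨hne, hA.isPreconnected⟩ hb ha)⟩
  have := interior_mono (subset_Icc_csInf_csSup hb ha)
  rwa [ho.interior_eq, interior_Icc] at this

/-! ### Growth of derivatives along an orbit -/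

/-- Growth estimate along an orbit `y` with derivative cocycle `D`, one-step derivatives `e` and
left branch endpoints `s`: each passage through a branch with `δ ≤ s k` contracts `y k / D k` by
`1 - δ`, all the other steps expand by `L`. -/
lemma two_le_cocycle {n V : ℕ} {y D e s : ℕ → ℝ} {δ κ L : ℝ} (hδ0 : 0 < δ) (hδ1 : δ < 1)
    (hκ0 : 0 < κ) (hκ1 : κ ≤ 1) (hL : 1 < L) (hV : (1 - δ) ^ V * 2 ≤ κ * δ)
    (hn : 2 ≤ (κ / L) ^ V * L ^ n) (hD0 : D 0 = 1) (hy0 : y 0 ≤ 1)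
    (hD : ∀ k < n, D (k + 1) = e k * D k) (heκ : ∀ k < n, κ ≤ e k)
    (heL : ∀ k < n, s k < δ → L ≤ e k) (hs0 : ∀ k < n, 0 ≤ s k) (hsy : ∀ k < n, s k < y k)
    (hy1 : ∀ k < n, y k ≤ 1) (hy : ∀ k < n, y (k + 1) ≤ e k * (y k - s k)) :
    2 ≤ D n := by
  classical
  let c : ℕ → ℕ := Nat.count fun k => δ ≤ s k
  have hpos : ∀ m ≤ n, 0 < D m := by
    intro m
    induction m with
    | zero => intro _; rw [hD0]; exact one_pos
    | succ m ih =>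
      intro hm
      rw [hD m hm]
      exact mul_pos (hκ0.trans_le (heκ m hm)) (ih (Nat.le_of_succ_le hm))
  have hlow : ∀ m ≤ n, (κ / L) ^ c m * L ^ m ≤ D m := by
    intro m
    induction m with
    | zero => intro _; simp [c, hD0]
    | succ m ih =>
      intro hm
      have ih := ih (Nat.le_of_succ_le hm)
      have hA : 0 ≤ (κ / L) ^ c m * L ^ m := by positivity
      rw [hD m hm]
      by_cases h : δ ≤ s m
      · have hc : c (m + 1) = c m + 1 := by simp [c, Nat.count_succ, h]
        calc (κ / L) ^ c (m + 1) * L ^ (m + 1) = κ * ((κ / L) ^ c m * L ^ m) := by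
              rw [hc, pow_succ, pow_succ]; field_simp
          _ ≤ e m * D m := mul_le_mul (heκ m hm) ih hA (hκ0.le.trans (heκ m hm))
      · have hc : c (m + 1) = c m := by simp [c, Nat.count_succ, h]
        have he := heL m hm (not_le.1 h)
        calc (κ / L) ^ c (m + 1) * L ^ (m + 1) = L * ((κ / L) ^ c m * L ^ m) := by
              rw [hc, pow_succ]; ring
          _ ≤ e m * D m := mul_le_mul he ih hA (by linarith)
  have hcontr : ∀ m ≤ n, y m ≤ D m * (1 - δ) ^ c m := by
    intro m
    induction m with
    | zero => intro _; simpa [c, hD0] using hy0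
    | succ m ih =>
      intro hm
      have ih := ih (Nat.le_of_succ_le hm)
      have hDm := hpos m (Nat.le_of_succ_le hm)
      have he : 0 ≤ e m := hκ0.le.trans (heκ m hm)
      have hs1 : s m ≤ 1 := (hsy m hm).le.trans (hy1 m hm)
      have hδ' : 0 ≤ 1 - δ := by linarith
      have hstep : y m - s m ≤ D m * (1 - δ) ^ c m * (1 - s m) := by
        have h₁ : y m - s m ≤ y m * (1 - s m) := by nlinarith [hs0 m hm, hy1 m hm]
        exact h₁.trans (mul_le_mul_of_nonneg_right ih (by linarith))
      have hfac : (1 - δ) ^ c m * (1 - s m) ≤ (1 - δ) ^ c (m + 1) := by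
        have hpow : 0 ≤ (1 - δ) ^ c m := pow_nonneg hδ' _
        by_cases h : δ ≤ s m
        · have hc : c (m + 1) = c m + 1 := by simp [c, Nat.count_succ, h]
          rw [hc, pow_succ]
          exact mul_le_mul_of_nonneg_left (by linarith) hpow
        · have hc : c (m + 1) = c m := by simp [c, Nat.count_succ, h]
          rw [hc]
          exact mul_le_of_le_one_right hpow (by linarith [hs0 m hm])
      calc y (m + 1) ≤ e m * (y m - s m) := hy m hm
        _ ≤ e m * (D m * ((1 - δ) ^ c m * (1 - s m))) := by
            rw [← mul_assoc (D m)]; exact mul_le_mul_of_nonneg_left hstep he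
        _ ≤ e m * (D m * (1 - δ) ^ c (m + 1)) := by gcongr
        _ = D (m + 1) * (1 - δ) ^ c (m + 1) := by rw [hD m hm]; ring
  have hmany : ∀ m ≤ n, V < c m → 2 ≤ D m := by
    intro m
    induction m with
    | zero => intro _ h; simp [c] at h
    | succ m ih =>
      intro hm h
      have hDm := hpos m (Nat.le_of_succ_le hm)
      rw [hD m hm]
      by_cases hδs : δ ≤ s m
      · have hc : c (m + 1) = c m + 1 := by simp [c, Nat.count_succ, hδs]
        have hVc : V ≤ c m := by omega
        have h₁ : δ ≤ D m * (1 - δ) ^ V := by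
          calc δ ≤ y m := hδs.trans (hsy m hm).le
            _ ≤ D m * (1 - δ) ^ c m := hcontr m (Nat.le_of_succ_le hm)
            _ ≤ D m * (1 - δ) ^ V := mul_le_mul_of_nonneg_left
                (pow_le_pow_of_le_one (by linarith) (by linarith) hVc) hDm.le
        have hq : 0 < (1 - δ) ^ V := pow_pos (by linarith) _
        have h₂ : (1 - δ) ^ V * 2 ≤ (1 - δ) ^ V * (κ * D m) := by nlinarith
        exact (le_of_mul_le_mul_left h₂ hq).trans (mul_le_mul_of_nonneg_right (heκ m hm) hDm.le)
      · have hc : c (m + 1) = c m := by simp [c, Nat.count_succ, hδs]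
        have ih := ih (Nat.le_of_succ_le hm) (hc ▸ h)
        nlinarith [heL m hm (not_le.1 hδs)]
  rcases lt_or_ge V (c n) with h | h
  · exact hmany n le_rfl h
  · refine hn.trans (le_trans ?_ (hlow n le_rfl))
    have : κ / L ≤ 1 := (div_le_one (by linarith)).2 (by linarith)
    exact mul_le_mul_of_nonneg_right (pow_le_pow_of_le_one (by positivity) this h) (by positivity)

namespace PCT

/-! ### Single branches -/

lemma a_nonneg (T : PCT) (i : ℕ) : 0 ≤ T.a i := by
  have h := (Icc_subset_Icc_iff (T.lt i).le).1
    ((closure_Ioo (T.lt i).ne ▸ closure_minimal (T.sub i) isClosed_Icc))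
  exact h.1

lemma eq_of_mem_of_mem (T : PCT) {i j : ℕ} {x : ℝ} (hi : x ∈ Ioo (T.a i) (T.b i))
    (hj : x ∈ Ioo (T.a j) (T.b j)) : i = j := by
  by_contra h
  exact (T.disj h).le_bot ⟨hi, hj⟩

lemma monotoneOn_deriv (T : PCT) (i : ℕ) : MonotoneOn (deriv T.τ) (Ioo (T.a i) (T.b i)) :=
  (T.conv i).monotoneOn_deriv (T.diff i)

lemma da_le_deriv (T : PCT) {i : ℕ} {x : ℝ} (hx : x ∈ Ioo (T.a i) (T.b i)) :
    T.da i ≤ deriv T.τ x := by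
  refine le_of_tendsto (T.deriv_lim i) ?_
  filter_upwards [Ioo_mem_nhdsGT hx.1] with z hz
  exact T.monotoneOn_deriv i ⟨hz.1, hz.2.trans hx.2⟩ hx hz.2.le

lemma τ_le_deriv_mul (T : PCT) {i : ℕ} {x : ℝ} (hx : x ∈ Ioo (T.a i) (T.b i)) :
    T.τ x ≤ deriv T.τ x * (x - T.a i) := by
  have hlim : Tendsto (fun z => T.τ x - T.τ z) (𝓝[>] T.a i) (𝓝 (T.τ x - 0)) :=
    tendsto_const_nhds.sub (T.lim_zero i)
  have hlim' : Tendsto (fun z => deriv T.τ x * (x - z)) (𝓝[>] T.a i)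
      (𝓝 (deriv T.τ x * (x - T.a i))) :=
    ((continuous_const.mul (continuous_const.sub continuous_id)).tendsto _).mono_left
      nhdsWithin_le_nhds
  rw [sub_zero] at hlim
  refine le_of_tendsto_of_tendsto hlim hlim' ?_
  filter_upwards [Ioo_mem_nhdsGT hx.1] with z hz
  have h := (T.conv i).slope_le_deriv ⟨hz.1, hz.2.trans hx.2⟩ hx hz.2 (T.diff i x hx)
  rwa [slope_def_field, div_le_iff₀ (sub_pos.2 hz.2)] at h

/-- The derivatives at the left endpoints are bounded away from zero. -/
lemma exists_le_da (T : PCT) : ∃ κ, 0 < κ ∧ κ ≤ 1 ∧ ∀ i, κ ≤ T.da i := by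
  have h0 : ∀ i, 0 ≤ 1 / T.da i := fun i => (one_div_pos.2 (T.da_pos i)).le
  have hS : 0 ≤ ∑' i, 1 / T.da i := tsum_nonneg h0
  refine ⟨1 / (1 + ∑' i, 1 / T.da i), by positivity,
    (div_le_one (by positivity)).2 (by linarith), fun i => ?_⟩
  rw [one_div_le (by positivity) (T.da_pos i)]
  linarith [T.sum_inv.le_tsum i fun j _ => h0 j]

/-- Branches whose left endpoint is close to `0` are uniformly expanding. -/
lemma exists_expanding_near_zero (T : PCT) :
    ∃ δ L, 0 < δ ∧ δ < 1 ∧ 1 < L ∧ ∀ i, T.a i < δ → L ≤ T.da i := by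
  by_cases hacc : AccPt (0 : ℝ) (𝓟 (range T.a))
  · have ha : ∀ i, 0 < T.a i := by
      intro i
      refine (T.a_nonneg i).lt_of_ne fun h => ?_
      have hb : T.b i ∈ Ioi (0 : ℝ) := h ▸ T.lt i
      obtain ⟨_, ⟨hjb, j, rfl⟩, hj0⟩ := accPt_iff_nhds.1 hacc (Iio (T.b i)) (Iio_mem_nhds hb)
      have hj : 0 < T.a j := (T.a_nonneg j).lt_of_ne' hj0
      obtain ⟨z, hz₁, hz₂⟩ := exists_between (lt_min hjb (T.lt j))
      have hij := T.eq_of_mem_of_mem (i := i) (j := j) (x := z)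
        ⟨h ▸ hj.trans hz₁, hz₂.trans_le (min_le_left _ _)⟩ ⟨hz₁, hz₂.trans_le (min_le_right _ _)⟩
      exact hj0 (hij ▸ h.symm)
    have hfin : {i | ¬ 1 / T.da i < 1 / 2}.Finite :=
      T.sum_inv.tendsto_cofinite_zero.eventually (gt_mem_nhds one_half_pos)
    have hev : ∀ᶠ δ in 𝓝[>] (0 : ℝ), ∀ i ∈ {i | ¬ 1 / T.da i < 1 / 2}, δ < T.a i :=
      (hfin.eventually_all).2 fun i _ => nhdsWithin_le_nhds (gt_mem_nhds (ha i))
    obtain ⟨δ, hδ, hδ0, hδ1⟩ := (hev.and (Ioo_mem_nhdsGT one_pos)).exists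
    refine ⟨δ, 2, hδ0, hδ1, one_lt_two, fun i hi => ?_⟩
    by_contra! h
    refine (hδ i ?_).not_gt hi
    rw [mem_ofPred_eq, not_lt]
    exact one_div_le_one_div_of_le (T.da_pos i) h.le
  · obtain ⟨i, hi, hda⟩ := T.expand hacc
    rw [accPt_iff_nhds] at hacc
    push Not at hacc
    obtain ⟨U, hU, hUa⟩ := hacc
    obtain ⟨ε, hε, hεU⟩ := Metric.mem_nhds_iff.1 hU
    refine ⟨min ε (1 / 2), T.da i, by positivity, (min_le_right _ _).trans_lt one_half_lt_one,
      hda, fun j hj => ?_⟩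
    have hj0 : T.a j = 0 := by
      refine hUa _ ⟨hεU ?_, mem_range_self j⟩
      rw [Metric.mem_ball, Real.dist_eq, sub_zero, abs_of_nonneg (T.a_nonneg j)]
      exact hj.trans_le (min_le_left _ _)
    obtain ⟨z, hz₁, hz₂⟩ := exists_between (lt_min (hi ▸ T.lt i) (hj0 ▸ T.lt j))
    rw [T.eq_of_mem_of_mem (i := i) (j := j) (x := z)
        ⟨hi.symm ▸ hz₁, hz₂.trans_le (min_le_left _ _)⟩
        ⟨hj0.symm ▸ hz₁, hz₂.trans_le (min_le_right _ _)⟩]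

/-! ### Cylinders of iterates -/

/-- The points whose first `n` iterates follow the branches prescribed by the word `w`. -/
def cylinder (T : PCT) {n : ℕ} (w : Fin n → ℕ) : Set ℝ :=
  {x | ∀ k : Fin n, T.τ^[k] x ∈ Ioo (T.a (w k)) (T.b (w k))}

lemma cylinder_succ (T : PCT) {n : ℕ} (w : Fin (n + 1) → ℕ) :
    T.cylinder w = T.cylinder (fun k : Fin n => w k.castSucc) ∩
      T.τ^[n] ⁻¹' Ioo (T.a (w (Fin.last n))) (T.b (w (Fin.last n))) := by
  ext x
  simp [cylinder, Fin.forall_fin_succ']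

lemma differentiableAt_iterate (T : PCT) {n : ℕ} {x : ℝ}
    (hx : ∀ k < n, ∃ i, T.τ^[k] x ∈ Ioo (T.a i) (T.b i)) : DifferentiableAt ℝ T.τ^[n] x := by
  induction n with
  | zero => exact differentiableAt_id
  | succ n ih =>
    obtain ⟨i, hi⟩ := hx n n.lt_succ_self
    rw [Function.iterate_succ']
    exact (T.diff i _ hi).comp x (ih fun k hk => hx k (hk.trans n.lt_succ_self))

lemma deriv_iterate_succ (T : PCT) {n : ℕ} {x : ℝ}
    (hx : ∀ k < n + 1, ∃ i, T.τ^[k] x ∈ Ioo (T.a i) (T.b i)) :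
    deriv T.τ^[n + 1] x = deriv T.τ (T.τ^[n] x) * deriv T.τ^[n] x := by
  obtain ⟨i, hi⟩ := hx n n.lt_succ_self
  rw [Function.iterate_succ']
  exact deriv_comp x (T.diff i _ hi)
    (T.differentiableAt_iterate fun k hk => hx k (hk.trans n.lt_succ_self))

lemma exists_mem_of_mem_cylinder (T : PCT) {n : ℕ} {w : Fin n → ℕ} {x : ℝ}
    (hx : x ∈ T.cylinder w) : ∀ k < n, ∃ i, T.τ^[k] x ∈ Ioo (T.a i) (T.b i) :=
  fun k hk => ⟨w ⟨k, hk⟩, hx ⟨k, hk⟩⟩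

lemma pairwise_disjoint_cylinder (T : PCT) (n : ℕ) :
    Pairwise (Function.onFun Disjoint fun w : Fin n → ℕ => T.cylinder w) := by
  intro v w hvw
  refine disjoint_left.2 fun x hv hw => hvw (funext fun k => ?_)
  exact T.eq_of_mem_of_mem (hv k) (hw k)

lemma isOpen_cylinder (T : PCT) {n : ℕ} (w : Fin n → ℕ) : IsOpen (T.cylinder w) := by
  induction n with
  | zero => simp [cylinder]
  | succ n ih =>
    rw [cylinder_succ]
    refine ContinuousOn.isOpen_inter_preimage (fun x hx => ?_) (ih _) isOpen_Ioo
    exact (T.differentiableAt_iterate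
      (T.exists_mem_of_mem_cylinder hx)).continuousAt.continuousWithinAt

lemma strictMonoOn_iterate (T : PCT) {n : ℕ} (w : Fin n → ℕ) :
    StrictMonoOn T.τ^[n] (T.cylinder w) := by
  induction n with
  | zero => exact strictMono_id.strictMonoOn _
  | succ n ih =>
    intro x hx y hy hxy
    rw [cylinder_succ] at hx hy
    rw [Function.iterate_succ_apply', Function.iterate_succ_apply']
    exact T.mono _ hx.2 hy.2 (ih _ hx.1 hy.1 hxy)

lemma ordConnected_cylinder (T : PCT) {n : ℕ} (w : Fin n → ℕ) :
    (T.cylinder w).OrdConnected := by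
  induction n with
  | zero => simpa [cylinder] using ordConnected_univ
  | succ n ih =>
    refine ⟨fun x hx y hy z hz => ?_⟩
    rw [cylinder_succ] at hx hy ⊢
    have hz' := (ih _).out hx.1 hy.1 hz
    have hmono := (T.strictMonoOn_iterate fun k : Fin n => w k.castSucc).monotoneOn
    exact ⟨hz', hx.2.1.trans_le (hmono hx.1 hz' hz.1), (hmono hz' hy.1 hz.2).trans_lt hy.2.2⟩

lemma deriv_iterate_bounds (T : PCT) {n : ℕ} (w : Fin n → ℕ) :
    (∀ x ∈ T.cylinder w, ∏ k, T.da (w k) ≤ deriv T.τ^[n] x) ∧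
      MonotoneOn (deriv T.τ^[n]) (T.cylinder w) := by
  induction n with
  | zero => simp [MonotoneOn]
  | succ n ih =>
    obtain ⟨ihle, ihmono⟩ := ih fun k => w k.castSucc
    have hprod : 0 < ∏ k : Fin n, T.da (w k.castSucc) := Finset.prod_pos fun k _ => T.da_pos _
    constructor
    · intro x hx
      rw [T.deriv_iterate_succ (T.exists_mem_of_mem_cylinder hx), Fin.prod_univ_castSucc, mul_comm]
      rw [cylinder_succ] at hx
      exact mul_le_mul (T.da_le_deriv hx.2) (ihle x hx.1) hprod.le
        ((T.da_pos _).le.trans (T.da_le_deriv hx.2))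
    · intro x hx y hy hxy
      rw [T.deriv_iterate_succ (T.exists_mem_of_mem_cylinder hx),
        T.deriv_iterate_succ (T.exists_mem_of_mem_cylinder hy)]
      rw [cylinder_succ] at hx hy
      have hτ := (T.strictMonoOn_iterate fun k : Fin n => w k.castSucc).monotoneOn hx.1 hy.1 hxy
      exact mul_le_mul (T.monotoneOn_deriv _ hx.2 hy.2 hτ) (ihmono hx.1 hy.1 hxy)
        (hprod.le.trans (ihle x hx.1)) ((T.da_pos _).le.trans (T.da_le_deriv hy.2))

/-- For `n ≥ 1` the branch intervals of `τ^n` are the nonempty cylinders of length `n`. -/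
lemma setOf_branchInterval_eq (T : PCT) {n : ℕ} (hn : 0 < n) :
    {y : ℝ | ∃ c d, IsBranchInterval T n c d ∧ y ∈ Ioo c d} =
      ⋃ w : Fin n → ℕ, T.cylinder w := by
  ext x
  simp only [mem_ofPred_eq, mem_iUnion]
  constructor
  · rintro ⟨c, d, ⟨⟨-, h⟩, -⟩, hx⟩
    choose w hw using fun k : Fin n => h k k.2
    exact ⟨w, fun k => hw k (mem_image_of_mem _ hx)⟩
  · rintro ⟨w, hx⟩
    have hsub : T.cylinder w ⊆ Icc 0 1 := fun z hz => T.sub _ (hz ⟨0, hn⟩)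
    obtain ⟨c, d, hcd⟩ := exists_eq_Ioo (T.ordConnected_cylinder w) (T.isOpen_cylinder w) ⟨x, hx⟩
      (bddBelow_Icc.mono hsub) (bddAbove_Icc.mono hsub)
    have hxcd : x ∈ Ioo c d := hcd ▸ hx
    have hlt : c < d := hxcd.1.trans hxcd.2
    refine ⟨c, d, ⟨⟨hlt, fun k hk => ⟨w ⟨k, hk⟩, ?_⟩⟩, fun c' d' hc hd h => ?_⟩, hxcd⟩
    · rintro _ ⟨z, hz, rfl⟩
      rw [← hcd] at hz
      exact hz ⟨k, hk⟩
    · have hincl : Ioo c' d' ⊆ Ioo c d := by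
        rw [← hcd]
        intro z hz k
        obtain ⟨i, hi⟩ := h.2 k k.2
        have hxi := hi (mem_image_of_mem _ (Ioo_subset_Ioo hc hd hxcd))
        rw [← T.eq_of_mem_of_mem hxi (hx k)]
        exact hi (mem_image_of_mem _ hz)
      have := (Ioo_subset_Ioo_iff h.1).1 hincl
      exact ⟨le_antisymm hc this.1, le_antisymm this.2 hd⟩

lemma mapsTo_iterate (T : PCT) (n : ℕ) : MapsTo T.τ^[n] (Icc 0 1) (Icc 0 1) :=
  T.maps_to.iterate n

/-- For large `n`, the derivative of `τ^n` is at least `2` wherever the first `n` iterates stay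
inside branches. -/
lemma exists_two_le_deriv_iterate (T : PCT) :
    ∃ N, ∀ n ≥ N, ∀ x ∈ Icc (0 : ℝ) 1,
      (∀ k < n, ∃ i, T.τ^[k] x ∈ Ioo (T.a i) (T.b i)) → 2 ≤ deriv T.τ^[n] x := by
  obtain ⟨κ, hκ0, hκ1, hκ⟩ := T.exists_le_da
  obtain ⟨δ, L, hδ0, hδ1, hL, hδL⟩ := T.exists_expanding_near_zero
  obtain ⟨V, hV⟩ := exists_pow_lt_of_lt_one (show 0 < κ * δ / 2 by positivity)
    (show 1 - δ < 1 by linarith)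
  have hc : 0 < (κ / L) ^ V := by positivity
  obtain ⟨N, hN⟩ := pow_unbounded_of_one_lt (2 / (κ / L) ^ V) hL
  refine ⟨N, fun n hn x hx01 hx => ?_⟩
  choose! i hi using hx
  refine two_le_cocycle (n := n) (V := V) (y := fun k => T.τ^[k] x)
    (D := fun k => deriv T.τ^[k] x) (e := fun k => deriv T.τ (T.τ^[k] x))
    (s := fun k => T.a (i k)) hδ0 hδ1 hκ0 hκ1 hL (by linarith) ?_ (by simp) hx01.2
    (fun k hk => T.deriv_iterate_succ fun l hl => ⟨i l, hi l (by omega)⟩)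
    (fun k hk => (hκ _).trans (T.da_le_deriv (hi k hk)))
    (fun k hk h => (hδL _ h).trans (T.da_le_deriv (hi k hk)))
    (fun k _ => T.a_nonneg _) (fun k hk => (hi k hk).1) (fun k _ => (T.mapsTo_iterate k hx01).2)
    (fun k hk => ?_)
  · rw [← div_le_iff₀' hc]
    exact hN.le.trans (pow_le_pow_right₀ hL.le hn)
  · simpa only [Function.iterate_succ_apply'] using T.τ_le_deriv_mul (hi k hk)

end PCT

/-- Theorem 2.2.2. Let `τ ∈ 𝒯`. Then for all sufficiently large `n`,
the iterate `τⁿ` belongs to the class `𝒯_E`: with `gₙ(x) := 1/(τⁿ)'(x)` on the branch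
intervals of `𝒫⁽ⁿ⁾` and `gₙ := 0` elsewhere, there exists `β < 1` such that
`sup_{x∈I} gₙ(x) ≤ β < 1` and `gₙ` has bounded variation on `I`. -/
theorem iterate_mem_expanding_class (T : PCT) :
    ∃ N : ℕ, ∀ n ≥ N, ∃ β : ℝ, β < 1 ∧
      (∀ x ∈ Set.Icc (0:ℝ) 1,
        Set.indicator {y : ℝ | ∃ c d, IsBranchInterval T n c d ∧ y ∈ Set.Ioo c d}
          (fun y => 1 / deriv (T.τ^[n]) y) x ≤ β) ∧
      BoundedVariationOn
        (Set.indicator {y : ℝ | ∃ c d, IsBranchInterval T n c d ∧ y ∈ Set.Ioo c d}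
          (fun y => 1 / deriv (T.τ^[n]) y)) (Set.Icc (0:ℝ) 1) := by
  obtain ⟨N, hN⟩ := T.exists_two_le_deriv_iterate
  refine ⟨max N 1, fun n hn => ⟨1 / 2, one_half_lt_one, fun x hx => ?_, ?_⟩⟩
  · rw [T.setOf_branchInterval_eq (le_of_max_le_right hn)]
    refine indicator_apply_le' (fun hmem => ?_) fun _ => one_half_pos.le
    obtain ⟨w, hw⟩ := mem_iUnion.1 hmem
    exact one_div_le_one_div_of_le two_pos
      (hN n (le_of_max_le_left hn) x hx (T.exists_mem_of_mem_cylinder hw))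
  · rw [T.setOf_branchInterval_eq (le_of_max_le_right hn)]
    have hpos : ∀ w : Fin n → ℕ, 0 < ∏ k, T.da (w k) := fun w =>
      Finset.prod_pos fun k _ => T.da_pos _
    have hsum : Summable fun w : Fin n → ℕ => 1 / ∏ k, T.da (w k) := by
      simpa using summable_prod_words T.sum_inv (fun i => (one_div_pos.2 (T.da_pos i)).le) n
    refine boundedVariationOn_indicator_iUnion T.ordConnected_cylinder
      (T.pairwise_disjoint_cylinder n) hsum (fun w => (one_div_pos.2 (hpos w)).le)
      (fun w x hx => ?_) (fun w x hx => ?_) (fun w x hx y hy hxy => ?_) 0 1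
    · exact one_div_nonneg.2 ((hpos w).le.trans ((T.deriv_iterate_bounds w).1 x hx))
    · exact one_div_le_one_div_of_le (hpos w) ((T.deriv_iterate_bounds w).1 x hx)
    · exact one_div_le_one_div_of_le ((hpos w).trans_le ((T.deriv_iterate_bounds w).1 x hx))
        ((T.deriv_iterate_bounds w).2 hx hy hxy)
end

section
/- Let τ belong to class 𝒯_E. Then for every sufficiently large n ∈ ℕ there exists B_n ∈ ℝ₊ such that for all f ∈ BV_I, var_I(P_{τ}^n f) ≤ (1/2)·var_I f + B_n·‖f‖_1, where P_τ^n is the Frobenius–Perron operator of the n-th iterate τ^n. -/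
open Set Filter MeasureTheory Topology

/-- The class `𝒯_E` of piecewise expanding maps of `[0,1]` with countably many branches:
`τ` restricted to each branch interval `(aᵢ, bᵢ)` is differentiable and extends to a
homeomorphism of `[aᵢ, bᵢ]` onto its image (a continuous injection `σ` agreeing with `τ`
on the interior), the branch intervals are pairwise disjoint and cover `[0,1]` up to a
null set, and `g = 1/|τ'|` on the branches (`0` elsewhere) satisfies
`sup g ≤ β < 1` and `var(g) < ∞`. -/
structure PET where
  τ : ℝ → ℝ
  a : ℕ → ℝ
  b : ℕ → ℝ
  g : ℝ → ℝ
  β : ℝ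
  maps_to : Set.MapsTo τ (Set.Icc 0 1) (Set.Icc 0 1)
  lt : ∀ i, a i < b i
  sub : ∀ i, Set.Ioo (a i) (b i) ⊆ Set.Icc (0:ℝ) 1
  disj : Pairwise (Function.onFun Disjoint fun i => Set.Ioo (a i) (b i))
  null : volume (Set.Icc (0:ℝ) 1 \ ⋃ i, Set.Ioo (a i) (b i)) = 0
  diff : ∀ i, ∀ x ∈ Set.Ioo (a i) (b i), DifferentiableAt ℝ τ x
  homeo : ∀ i, ∃ σ : ℝ → ℝ, ContinuousOn σ (Set.Icc (a i) (b i)) ∧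
      Set.InjOn σ (Set.Icc (a i) (b i)) ∧ Set.EqOn σ τ (Set.Ioo (a i) (b i))
  g_eq : ∀ i, ∀ x ∈ Set.Ioo (a i) (b i), g x = 1 / |deriv τ x|
  g_zero : ∀ x, x ∉ (⋃ i, Set.Ioo (a i) (b i)) → g x = 0
  β_lt : β < 1
  g_le : ∀ x ∈ Set.Icc (0:ℝ) 1, g x ≤ β
  g_bv : BoundedVariationOn g (Set.Icc (0:ℝ) 1)


open scoped ENNReal

/-! ### Variation over a disjoint family of intervals -/

theorem tsum_eVariationOn_Icc_le {a b : ℕ → ℝ} (hlt : ∀ i, a i < b i)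
    (hdisj : Pairwise (Function.onFun Disjoint fun i => Ioo (a i) (b i)))
    {s : Set ℝ} (hs : ∀ i, Icc (a i) (b i) ⊆ s) (u : ℝ → ℝ) :
    ∑' i, eVariationOn u (Icc (a i) (b i)) ≤ eVariationOn u s := by
  classical
  have key : ∀ t : Finset ℕ, ∑ i ∈ t, eVariationOn u (Icc (a i) (b i)) ≤
      eVariationOn u (⋃ i ∈ t, Icc (a i) (b i)) := by
    intro t
    induction t using Finset.induction_on_max_value a with
    | empty => simp
    | insert i t hi hmax ih =>
      rw [Finset.sum_insert hi, Finset.set_biUnion_insert, add_comm, union_comm]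
      refine (add_le_add_left ih _).trans (eVariationOn.add_le_union u ?_)
      intro x hx y hy
      simp only [mem_iUnion, exists_prop] at hx
      obtain ⟨j, hj, hxj⟩ := hx
      have hij : j ≠ i := fun h => hi (h ▸ hj)
      have hba : b j ≤ a i := by
        by_contra! hcon
        obtain ⟨z, hz1, hz2⟩ := exists_between (lt_min hcon (hlt i))
        exact disjoint_left.1 (hdisj hij)
          ⟨(hmax j hj).trans_lt hz1, hz2.trans_le (min_le_left _ _)⟩
          ⟨hz1, hz2.trans_le (min_le_right _ _)⟩
      exact hxj.2.trans (hba.trans hy.1)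
  rw [ENNReal.tsum_eq_iSup_sum]
  exact iSup_le fun t => (key t).trans (eVariationOn.mono u (iUnion₂_subset fun i _ => hs i))

theorem eVariationOn_le_tsum_Icc {a b : ℕ → ℝ} {u : ℝ → ℝ}
    (ha : ∀ i, u (a i) = 0) (hb : ∀ i, u (b i) = 0)
    (hu : ∀ x, x ∉ ⋃ i, Ioo (a i) (b i) → u x = 0) (s : Set ℝ) :
    eVariationOn u s ≤ ∑' i, eVariationOn u (Icc (a i) (b i)) := by
  have left : ∀ i s t, s ≤ t → s ∈ Ioo (a i) (b i) → t ∉ Ioo (a i) (b i) →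
      ‖u s‖ₑ ≤ eVariationOn u (Icc (a i) (b i) ∩ Icc s t) := by
    intro i s t hst hs ht
    have hbt : b i ≤ t := by
      by_contra! h
      exact ht ⟨hs.1.trans_le hst, h⟩
    have := eVariationOn.edist_le u (s := Icc (a i) (b i) ∩ Icc s t) (x := s) (y := b i)
      ⟨Ioo_subset_Icc_self hs, le_rfl, hst⟩ ⟨⟨(hs.1.trans hs.2).le, le_rfl⟩, hs.2.le, hbt⟩
    rwa [hb, edist_zero_right] at this
  have right : ∀ i s t, s ≤ t → t ∈ Ioo (a i) (b i) → s ∉ Ioo (a i) (b i) →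
      ‖u t‖ₑ ≤ eVariationOn u (Icc (a i) (b i) ∩ Icc s t) := by
    intro i s t hst ht hs
    have hsa : s ≤ a i := by
      by_contra! h
      exact hs ⟨h, hst.trans_lt ht.2⟩
    have := eVariationOn.edist_le u (s := Icc (a i) (b i) ∩ Icc s t) (x := t) (y := a i)
      ⟨Ioo_subset_Icc_self ht, hst, le_rfl⟩ ⟨⟨le_rfl, (ht.1.trans ht.2).le⟩, hsa, ht.1.le⟩
    rwa [ha, edist_zero_right] at this
  have same : ∀ i s t, s ≤ t → s ∈ Ioo (a i) (b i) → t ∈ Ioo (a i) (b i) →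
      edist (u t) (u s) ≤ ∑' i, eVariationOn u (Icc (a i) (b i) ∩ Icc s t) := by
    intro i s t hst hs ht
    have := eVariationOn.edist_le u (s := Icc (a i) (b i) ∩ Icc s t) (x := t) (y := s)
      ⟨Ioo_subset_Icc_self ht, hst, le_rfl⟩ ⟨Ioo_subset_Icc_self hs, le_rfl, hst⟩
    exact this.trans (ENNReal.le_tsum i)
  have step : ∀ s t, s ≤ t → edist (u t) (u s) ≤
      ∑' i, eVariationOn u (Icc (a i) (b i) ∩ Icc s t) := by
    intro s t hst
    by_cases hs : ∃ i, s ∈ Ioo (a i) (b i)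
    · obtain ⟨i, hi⟩ := hs
      by_cases hti : t ∈ Ioo (a i) (b i)
      · exact same i s t hst hi hti
      by_cases ht : ∃ j, t ∈ Ioo (a j) (b j)
      · obtain ⟨j, hj⟩ := ht
        have hij : i ≠ j := fun h => hti (h ▸ hj)
        by_cases hsj : s ∈ Ioo (a j) (b j)
        · exact same j s t hst hsj hj
        calc edist (u t) (u s) ≤ edist (u t) 0 + edist 0 (u s) := edist_triangle _ _ _
          _ = ‖u s‖ₑ + ‖u t‖ₑ := by
            rw [edist_zero_right, edist_zero_left, add_comm]; rfl
          _ ≤ _ := add_le_add (left i s t hst hi hti) (right j s t hst hj hsj)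
          _ = ∑ k ∈ {i, j}, eVariationOn u (Icc (a k) (b k) ∩ Icc s t) :=
            (Finset.sum_pair (f := fun k => eVariationOn u (Icc (a k) (b k) ∩ Icc s t)) hij).symm
          _ ≤ _ := ENNReal.sum_le_tsum _
      · rw [hu t (by simpa using ht), edist_zero_left]
        exact (left i s t hst hi hti).trans (ENNReal.le_tsum i)
    · rw [hu s (by simpa using hs), edist_zero_right]
      by_cases ht : ∃ j, t ∈ Ioo (a j) (b j)
      · obtain ⟨j, hj⟩ := ht
        exact (right j s t hst hj fun h => hs ⟨j, h⟩).trans (ENNReal.le_tsum j)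
      · simp [hu t (by simpa using ht)]
  refine iSup_le ?_
  rintro ⟨n, p, hp, -⟩
  calc ∑ k ∈ Finset.range n, edist (u (p (k + 1))) (u (p k))
      ≤ ∑ k ∈ Finset.range n, ∑' i, eVariationOn u (Icc (a i) (b i) ∩ Icc (p k) (p (k + 1))) :=
        Finset.sum_le_sum fun k _ => step _ _ (hp k.le_succ)
    _ = ∑' i, ∑ k ∈ Finset.range n,
          eVariationOn u (Icc (a i) (b i) ∩ Icc (p k) (p (k + 1))) :=
        (Summable.tsum_finsetSum fun _ _ => ENNReal.summable).symm
    _ ≤ _ := ENNReal.tsum_le_tsum fun i => ?_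
  have : ∀ m, ∑ k ∈ Finset.range m, eVariationOn u (Icc (a i) (b i) ∩ Icc (p k) (p (k + 1))) ≤
      eVariationOn u (Icc (a i) (b i) ∩ Iic (p m)) := by
    intro m
    induction m with
    | zero => simp
    | succ m ih =>
      rw [Finset.sum_range_succ]
      refine (add_le_add_left ih _).trans ((eVariationOn.add_le_union u ?_).trans
        (eVariationOn.mono u ?_))
      · exact fun x hx y hy => (mem_Iic.1 hx.2).trans hy.2.1
      · exact union_subset
          (inter_subset_inter_right _ (Iic_subset_Iic.2 (hp m.le_succ)))
          (inter_subset_inter_right _ Icc_subset_Iic_self)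
  exact (this n).trans (eVariationOn.mono u inter_subset_left)

theorem eVariationOn_tsum_le {F : ℕ → ℝ → ℝ} {s : Set ℝ}
    (hF : ∀ x ∈ s, Summable fun i => F i x) :
    eVariationOn (fun x => ∑' i, F i x) s ≤ ∑' i, eVariationOn (F i) s := by
  refine iSup_le ?_
  rintro ⟨n, p, hp, hps⟩
  calc ∑ k ∈ Finset.range n, edist (∑' i, F i (p (k + 1))) (∑' i, F i (p k))
      ≤ ∑ k ∈ Finset.range n, ∑' i, edist (F i (p (k + 1))) (F i (p k)) := by
        refine Finset.sum_le_sum fun k _ => ?_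
        rw [edist_eq_enorm_sub, ← (hF _ (hps _)).tsum_sub (hF _ (hps _))]
        simp_rw [edist_eq_enorm_sub]
        exact enorm_tsum_le_tsum_enorm
    _ = ∑' i, ∑ k ∈ Finset.range n, edist (F i (p (k + 1))) (F i (p k)) :=
        (Summable.tsum_finsetSum fun _ _ => ENNReal.summable).symm
    _ ≤ _ := ENNReal.tsum_le_tsum fun i => eVariationOn.sum_le hp hps

/-! ### Multiplication by a small weight of bounded variation -/

theorem enorm_le_eVariationOn_add_integral {a b : ℝ} (hab : a < b) {f : ℝ → ℝ}
    (hf : IntegrableOn f (Icc a b)) (hfv : BoundedVariationOn f (Icc a b)) {x : ℝ}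
    (hx : x ∈ Icc a b) :
    ‖f x‖ₑ ≤ eVariationOn f (Icc a b) + ENNReal.ofReal ((b - a)⁻¹ * ∫ y in Icc a b, |f y|) := by
  have hpos : 0 < b - a := sub_pos.2 hab
  have h1 : |f x| * (b - a) ≤
      (eVariationOn f (Icc a b)).toReal * (b - a) + ∫ y in Icc a b, |f y| := by
    have h2 : ∫ _ in Icc a b, |f x| ≤
        ∫ y in Icc a b, ((eVariationOn f (Icc a b)).toReal + |f y|) := by
      refine setIntegral_mono_on (integrableOn_const (by simp))
        ((integrableOn_const (by simp)).add hf.abs) measurableSet_Icc fun y hy => ?_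
      have h3 := hfv.dist_le hx hy
      rw [Real.dist_eq] at h3
      linarith [abs_sub_abs_le_abs_sub (f x) (f y)]
    rw [integral_add (integrable_const _) hf.abs] at h2
    simp only [integral_const, MeasurableSet.univ, measureReal_restrict_apply, univ_inter,
      Real.volume_real_Icc, max_eq_left hpos.le, smul_eq_mul] at h2
    linarith
  have h4 : |f x| ≤ (eVariationOn f (Icc a b)).toReal +
      (b - a)⁻¹ * ∫ y in Icc a b, |f y| := by
    rw [← mul_le_mul_iff_left₀ hpos]
    refine h1.trans_eq ?_
    field_simp
  rw [← ENNReal.ofReal_toReal hfv, ← ENNReal.ofReal_add ENNReal.toReal_nonneg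
    (mul_nonneg (inv_nonneg.2 hpos.le) (integral_nonneg fun _ => abs_nonneg _)),
    Real.enorm_eq_ofReal_abs]
  exact ENNReal.ofReal_le_ofReal h4

/-- On `[a, b]`, multiplication by `h` satisfies a Lasota–Yorke estimate with constant `3 * c`. -/
def MulVariationBound (h : ℝ → ℝ) (c a b : ℝ) : Prop :=
  ∃ B : ℝ, 0 < B ∧ ∀ f : ℝ → ℝ, IntegrableOn f (Icc a b) → BoundedVariationOn f (Icc a b) →
    eVariationOn (fun x => h x * f x) (Icc a b) ≤
      ENNReal.ofReal (3 * c) * eVariationOn f (Icc a b) +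
      ENNReal.ofReal (B * ∫ x in Icc a b, |f x|)

namespace MulVariationBound

variable {h : ℝ → ℝ} {c x y z : ℝ}

theorem trans (hxy : x ≤ y) (hyz : y ≤ z) (h₁ : MulVariationBound h c x y)
    (h₂ : MulVariationBound h c y z) : MulVariationBound h c x z := by
  obtain ⟨B₁, hB₁, H₁⟩ := h₁
  obtain ⟨B₂, hB₂, H₂⟩ := h₂
  refine ⟨max B₁ B₂, lt_max_of_lt_left hB₁, fun f hf hfv => ?_⟩
  have sub₁ : Icc x y ⊆ Icc x z := Icc_subset_Icc_right hyz
  have sub₂ : Icc y z ⊆ Icc x z := Icc_subset_Icc_left hxy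
  have split : ∀ k : ℝ → ℝ, eVariationOn k (Icc x y) + eVariationOn k (Icc y z) =
      eVariationOn k (Icc x z) := fun k => by
    simpa using eVariationOn.Icc_add_Icc k (s := univ) hxy hyz (mem_univ _)
  have hint : ∫ t in Icc x z, |f t| = (∫ t in Icc x y, |f t|) + ∫ t in Icc y z, |f t| := by
    simp only [integral_Icc_eq_integral_Ioc]
    rw [← Ioc_union_Ioc_eq_Ioc hxy hyz]
    exact setIntegral_union (Ioc_disjoint_Ioc_of_le le_rfl) measurableSet_Ioc
      (hf.mono_set (Ioc_subset_Icc_self.trans sub₁)).abs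
      (hf.mono_set (Ioc_subset_Icc_self.trans sub₂)).abs
  have pos : ∀ s : Set ℝ, 0 ≤ ∫ t in s, |f t| := fun s => integral_nonneg fun _ => abs_nonneg _
  rw [← split, ← split f, hint, mul_add, mul_add,
    ENNReal.ofReal_add (mul_nonneg (hB₁.le.trans (le_max_left _ _)) (pos _))
      (mul_nonneg (hB₁.le.trans (le_max_left _ _)) (pos _)), add_add_add_comm]
  refine add_le_add ((H₁ f (hf.mono_set sub₁) (hfv.mono sub₁)).trans ?_)
    ((H₂ f (hf.mono_set sub₂) (hfv.mono sub₂)).trans ?_)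
  · gcongr
    exact le_max_left _ _
  · gcongr
    exact le_max_right _ _

theorem of_eVariationOn_le (hc : 0 < c) (hxy : x ≤ y) (hb : ∀ t ∈ Icc x y, |h t| ≤ c)
    (hv : eVariationOn h (Icc x y) ≤ ENNReal.ofReal (2 * c)) : MulVariationBound h c x y := by
  rcases hxy.eq_or_lt with rfl | hlt
  · exact ⟨1, one_pos, fun f _ _ => by simp⟩
  have hpos : 0 < y - x := sub_pos.2 hlt
  refine ⟨2 * c * (y - x)⁻¹, by positivity, fun f hf hfv => ?_⟩
  calc eVariationOn (fun t => h t * f t) (Icc x y)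
      ≤ ENNReal.ofReal c * eVariationOn f (Icc x y) +
        (eVariationOn f (Icc x y) + ENNReal.ofReal ((y - x)⁻¹ * ∫ t in Icc x y, |f t|)) *
          eVariationOn h (Icc x y) :=
        eVariationOn_fun_mul_le
          (fun t ht => by rw [Real.enorm_eq_ofReal_abs]; exact ENNReal.ofReal_le_ofReal (hb t ht))
          (fun t ht => enorm_le_eVariationOn_add_integral hlt hf hfv ht)
    _ ≤ ENNReal.ofReal c * eVariationOn f (Icc x y) +
        (eVariationOn f (Icc x y) + ENNReal.ofReal ((y - x)⁻¹ * ∫ t in Icc x y, |f t|)) *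
          ENNReal.ofReal (2 * c) := by gcongr
    _ = _ := by
        have e1 : ENNReal.ofReal (3 * c) = ENNReal.ofReal c + ENNReal.ofReal (2 * c) := by
          rw [← ENNReal.ofReal_add hc.le (by positivity)]; congr 1; ring
        have e2 : ENNReal.ofReal (2 * c * (y - x)⁻¹ * ∫ t in Icc x y, |f t|) =
            ENNReal.ofReal (2 * c) * ENNReal.ofReal ((y - x)⁻¹ * ∫ t in Icc x y, |f t|) := by
          rw [← ENNReal.ofReal_mul (by positivity), mul_assoc]
        rw [e1, e2]
        ring

theorem of_boundedVariationOn (hc : 0 < c) (hxy : x ≤ y) (h0 : ∀ t ∈ Icc x y, 0 ≤ h t)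
    (hb : ∀ t ∈ Icc x y, h t ≤ c) (hv : BoundedVariationOn h (Icc x y)) :
    MulVariationBound h c x y := by
  have habs : ∀ t ∈ Icc x y, |h t| ≤ c := fun t ht => by rw [abs_of_nonneg (h0 t ht)]; exact hb t ht
  have hc' : ENNReal.ofReal c ≠ 0 := by simpa using hc
  -- a partition whose sum is within `c` of the total variation
  obtain ⟨m, p, hp, hps, hsum⟩ : ∃ (m : ℕ) (p : ℕ → ℝ), Monotone p ∧ (∀ i, p i ∈ Icc x y) ∧
      eVariationOn h (Icc x y) ≤
        ∑ i ∈ Finset.range m, edist (h (p (i + 1))) (h (p i)) + ENNReal.ofReal c := by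
    by_cases hz : eVariationOn h (Icc x y) = 0
    · exact ⟨0, fun _ => x, monotone_const, fun _ => ⟨le_rfl, hxy⟩, by simp [hz]⟩
    obtain ⟨⟨m, p, hp, hps⟩, hlt⟩ := lt_iSup_iff.1 (ENNReal.sub_lt_self hv hz hc')
    exact ⟨m, p, hp, hps, tsub_le_iff_right.1 hlt.le⟩
  set e : ℕ → ℝ≥0∞ := fun i => edist (h (p (i + 1))) (h (p i))
  have he : ∀ i, e i ≤ eVariationOn h (Icc (p i) (p (i + 1))) := fun i =>
    eVariationOn.edist_le h (right_mem_Icc.2 (hp i.le_succ)) (left_mem_Icc.2 (hp i.le_succ))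
  have hsum' := eVariationOn.sum' h hp (n := m)
  have split : eVariationOn h (Icc x (p 0)) + eVariationOn h (Icc (p 0) (p m)) +
      eVariationOn h (Icc (p m) y) = eVariationOn h (Icc x y) := by
    have h1 := eVariationOn.Icc_add_Icc h (s := univ) (hps 0).1 (hp m.zero_le) (mem_univ _)
    have h2 := eVariationOn.Icc_add_Icc h (s := univ) (hps m).1 (hps m).2 (mem_univ _)
    simp only [univ_inter] at h1 h2
    rw [h1, h2]
  have hE : ∑ i ∈ Finset.range m, e i ≤ eVariationOn h (Icc (p 0) (p m)) :=
    hsum' ▸ Finset.sum_le_sum fun i _ => he i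
  have hEtop : ∑ i ∈ Finset.range m, e i ≠ ⊤ :=
    ne_top_of_le_ne_top hv ((hE.trans le_add_self).trans (le_self_add.trans split.le))
  have hc2 : ENNReal.ofReal c ≤ ENNReal.ofReal (2 * c) := ENNReal.ofReal_le_ofReal (by linarith)
  have first : eVariationOn h (Icc x (p 0)) ≤ ENNReal.ofReal c := by
    refine (ENNReal.add_le_add_iff_left hEtop).1 (le_trans ?_ hsum)
    rw [← split, add_comm]
    exact (add_le_add_right hE _).trans le_self_add
  have last : eVariationOn h (Icc (p m) y) ≤ ENNReal.ofReal c := by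
    refine (ENNReal.add_le_add_iff_left hEtop).1 (le_trans ?_ hsum)
    rw [← split]
    exact add_le_add_left (hE.trans le_add_self) _
  have mid : ∀ k < m, eVariationOn h (Icc (p k) (p (k + 1))) ≤ ENNReal.ofReal (2 * c) := by
    intro k hk
    have hk' : k ∈ Finset.range m := Finset.mem_range.2 hk
    have hrest : ∑ i ∈ (Finset.range m).erase k, e i ≠ ⊤ :=
      ne_top_of_le_ne_top hEtop (Finset.sum_le_sum_of_subset (Finset.erase_subset _ _))
    have h1 : ∑ i ∈ (Finset.range m).erase k, e i + eVariationOn h (Icc (p k) (p (k + 1))) ≤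
        ∑ i ∈ (Finset.range m).erase k, e i + (e k + ENNReal.ofReal c) := by
      rw [← add_assoc, Finset.sum_erase_add _ _ hk']
      refine le_trans ?_ hsum
      refine le_trans ?_ ((le_add_self.trans le_self_add).trans split.le)
      rw [← hsum', ← Finset.sum_erase_add _ _ hk']
      exact add_le_add_left (Finset.sum_le_sum fun i _ => he i) _
    refine ((ENNReal.add_le_add_iff_left hrest).1 h1).trans ?_
    have h2 : e k ≤ ENNReal.ofReal c := by
      simp only [e, edist_dist, Real.dist_eq]
      refine ENNReal.ofReal_le_ofReal (abs_sub_le_iff.2 ⟨?_, ?_⟩)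
      · linarith [hb _ (hps (k + 1)), h0 _ (hps k)]
      · linarith [hb _ (hps k), h0 _ (hps (k + 1))]
    rw [two_mul, ENNReal.ofReal_add hc.le hc.le]
    exact add_le_add_left h2 _
  have chain : ∀ k ≤ m, MulVariationBound h c x (p k) := by
    intro k
    induction k with
    | zero =>
      exact fun _ => of_eVariationOn_le hc (hps 0).1
        (fun t ht => habs t ⟨ht.1, ht.2.trans (hps 0).2⟩) (first.trans hc2)
    | succ k ih =>
      exact fun hk => (ih (by omega)).trans (hps k).1 (hp k.le_succ)
        (of_eVariationOn_le hc (hp k.le_succ)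
          (fun t ht => habs t ⟨(hps k).1.trans ht.1, ht.2.trans (hps (k + 1)).2⟩)
          (mid k (by omega)))
  exact (chain m le_rfl).trans (hps m).1 (hps m).2 (of_eVariationOn_le hc (hps m).2
    (fun t ht => habs t ⟨(hps m).1.trans ht.1, ht.2⟩) (last.trans hc2))

end MulVariationBound

/-! ### Inverse branches -/

theorem StrictMonoOn.exists_monotone_leftInverse {a b : ℝ} (hab : a ≤ b) {σ : ℝ → ℝ}
    (hσ : StrictMonoOn σ (Icc a b)) (hc : ContinuousOn σ (Icc a b)) :
    ∃ Y : ℝ → ℝ, Monotone Y ∧ (∀ x, Y x ∈ Icc a b) ∧ (∀ x, Y x ∈ Ioo a b → σ (Y x) = x) ∧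
      ∀ y ∈ Ioo a b, Y (σ y) = y := by
  have ha := left_mem_Icc.2 hab
  have hb := right_mem_Icc.2 hab
  have hσab : σ a ≤ σ b := hσ.monotoneOn ha hb hab
  have hsurj : ∀ x, ∃ y ∈ Icc a b, σ y = max (σ a) (min x (σ b)) := fun x =>
    intermediate_value_Icc hab hc ⟨le_max_left _ _, max_le hσab (min_le_right _ _)⟩
  choose Y hY hσY using hsurj
  refine ⟨Y, fun x x' h => ?_, hY, fun x hx => ?_, fun y hy => ?_⟩
  · rw [← hσ.le_iff_le (hY x) (hY x'), hσY, hσY]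
    gcongr
  · have h1 := hσ ha (hY x) hx.1
    have h2 := hσ (hY x) hb hx.2
    rw [hσY] at h1 h2 ⊢
    grind
  · have hy' := Ioo_subset_Icc_self hy
    refine hσ.injOn (hY _) hy' ?_
    rw [hσY, min_eq_left (hσ.monotoneOn hy' hb hy'.2), max_eq_right (hσ.monotoneOn ha hy' hy'.1)]

namespace PET

variable (T : PET)

/-- The union of the branch intervals. -/
def dom : Set ℝ := ⋃ i, Ioo (T.a i) (T.b i)

/-- The map `τ`, replaced by `0` off the branch intervals so that it becomes measurable. -/
noncomputable def cutMap : ℝ → ℝ := T.dom.indicator T.τ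

variable {T}

theorem Ioo_subset_dom (i : ℕ) : Ioo (T.a i) (T.b i) ⊆ T.dom :=
  subset_iUnion (fun i => Ioo (T.a i) (T.b i)) i

theorem measurableSet_dom : MeasurableSet T.dom :=
  MeasurableSet.iUnion fun _ => measurableSet_Ioo

theorem Icc_subset (i : ℕ) : Icc (T.a i) (T.b i) ⊆ Icc 0 1 := by
  rw [← closure_Ioo (T.lt i).ne]
  exact closure_minimal (T.sub i) isClosed_Icc

theorem notMem_dom_of_mem_Icc {i : ℕ} {x : ℝ} (hx : x ∈ Icc (T.a i) (T.b i))
    (hx' : x ∉ Ioo (T.a i) (T.b i)) : x ∉ T.dom := by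
  intro h
  obtain ⟨j, hj⟩ := mem_iUnion.1 h
  have hij : i ≠ j := fun h => hx' (h ▸ hj)
  have hd := T.disj hij
  have hcl : x ∈ closure (Ioo (T.a i) (T.b i)) := by rwa [closure_Ioo (T.lt i).ne]
  exact disjoint_left.1 (hd.closure_left isOpen_Ioo) hcl hj

theorem g_eq_zero_of_mem_Icc {i : ℕ} {x : ℝ} (hx : x ∈ Icc (T.a i) (T.b i))
    (hx' : x ∉ Ioo (T.a i) (T.b i)) : T.g x = 0 :=
  T.g_zero x (notMem_dom_of_mem_Icc hx hx')

theorem g_left (i : ℕ) : T.g (T.a i) = 0 :=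
  g_eq_zero_of_mem_Icc (left_mem_Icc.2 (T.lt i).le) (by simp)

theorem g_right (i : ℕ) : T.g (T.b i) = 0 :=
  g_eq_zero_of_mem_Icc (right_mem_Icc.2 (T.lt i).le) (by simp)

theorem g_nonneg (x : ℝ) : 0 ≤ T.g x := by
  by_cases hx : x ∈ T.dom
  · obtain ⟨i, hi⟩ := mem_iUnion.1 hx
    rw [T.g_eq i x hi]
    positivity
  · exact (T.g_zero x hx).ge

theorem β_nonneg : 0 ≤ T.β := (g_nonneg 0).trans (T.g_le 0 (by simp))

theorem cutMap_eq {i : ℕ} {x : ℝ} (hx : x ∈ Ioo (T.a i) (T.b i)) : T.cutMap x = T.τ x :=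
  indicator_of_mem (Ioo_subset_dom i hx) _

theorem cutMap_mem {x : ℝ} (hx : x ∈ Icc (0 : ℝ) 1) : T.cutMap x ∈ Icc (0 : ℝ) 1 := by
  by_cases h : x ∈ T.dom
  · rw [cutMap, indicator_of_mem h]
    exact T.maps_to hx
  · simp [cutMap, indicator_of_notMem h]

theorem hasDerivAt_cutMap {i : ℕ} {x : ℝ} (hx : x ∈ Ioo (T.a i) (T.b i)) :
    HasDerivAt T.cutMap (deriv T.τ x) x :=
  (T.diff i x hx).hasDerivAt.congr_of_eventuallyEq <|
    Filter.eventually_of_mem (isOpen_Ioo.mem_nhds hx) fun _ hy => cutMap_eq hy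

theorem measurable_cutMap : Measurable T.cutMap := by
  classical
  have hc : ContinuousOn T.τ T.dom := fun x hx => by
    obtain ⟨i, hi⟩ := mem_iUnion.1 hx
    exact (T.diff i x hi).continuousAt.continuousWithinAt
  have := hc.measurable_piecewise (continuousOn_const (c := (0 : ℝ))) measurableSet_dom
  rwa [show T.cutMap = T.dom.piecewise T.τ (fun _ => 0) by
    ext x
    by_cases hx : x ∈ T.dom <;> simp [cutMap, hx]]

variable (T) in
theorem exists_strictMonoOn_or_strictAntiOn (i : ℕ) : ∃ σ : ℝ → ℝ,
    ContinuousOn σ (Icc (T.a i) (T.b i)) ∧ EqOn σ T.τ (Ioo (T.a i) (T.b i)) ∧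
    MapsTo σ (Icc (T.a i) (T.b i)) (Icc 0 1) ∧
    (StrictMonoOn σ (Icc (T.a i) (T.b i)) ∨ StrictAntiOn σ (Icc (T.a i) (T.b i))) := by
  obtain ⟨σ, hc, hinj, heq⟩ := T.homeo i
  refine ⟨σ, hc, heq, ?_, hc.strictMonoOn_of_injOn_Icc' (T.lt i).le hinj⟩
  have hm : MapsTo σ (Ioo (T.a i) (T.b i)) (Icc 0 1) := fun x hx => by
    rw [heq hx]
    exact T.maps_to (T.sub i hx)
  have := hm.closure_of_continuousOn (by rwa [closure_Ioo (T.lt i).ne])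
  rwa [closure_Ioo (T.lt i).ne, isClosed_Icc.closure_eq] at this

variable (T) in
theorem exists_invBranch (i : ℕ) : ∃ Y : ℝ → ℝ, (Monotone Y ∨ Antitone Y) ∧
    (∀ x, Y x ∈ Icc (T.a i) (T.b i)) ∧ (∀ x, Y x ∈ Ioo (T.a i) (T.b i) → T.cutMap (Y x) = x) ∧
    ∀ y ∈ Ioo (T.a i) (T.b i), Y (T.cutMap y) = y := by
  obtain ⟨σ, hc, heq, -, hmono | hanti⟩ := T.exists_strictMonoOn_or_strictAntiOn i
  · obtain ⟨Y, hY, h1, h2, h3⟩ := hmono.exists_monotone_leftInverse (T.lt i).le hc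
    refine ⟨Y, .inl hY, h1, fun x hx => ?_, fun y hy => ?_⟩
    · rw [cutMap_eq hx, ← heq hx, h2 x hx]
    · rw [cutMap_eq hy, ← heq hy, h3 y hy]
  · obtain ⟨Y, hY, h1, h2, h3⟩ := hanti.neg.exists_monotone_leftInverse (T.lt i).le hc.neg
    refine ⟨fun x => Y (-x), .inr fun x y hxy => hY (neg_le_neg hxy), fun x => h1 _,
      fun x hx => ?_, fun y hy => ?_⟩
    · rw [cutMap_eq hx, ← heq hx, ← neg_inj]
      exact h2 _ hx
    · dsimp only
      rw [cutMap_eq hy, ← heq hy]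
      exact h3 y hy

variable (T) in
/-- A monotone or antitone extension to `ℝ` of the inverse of the `i`-th branch. -/
noncomputable def invBranch (i : ℕ) : ℝ → ℝ := (T.exists_invBranch i).choose

theorem invBranch_monotone_or_antitone (i : ℕ) :
    Monotone (T.invBranch i) ∨ Antitone (T.invBranch i) := (T.exists_invBranch i).choose_spec.1

theorem invBranch_mem (i : ℕ) (x : ℝ) : T.invBranch i x ∈ Icc (T.a i) (T.b i) :=
  (T.exists_invBranch i).choose_spec.2.1 x

theorem cutMap_invBranch {i : ℕ} {x : ℝ} (hx : T.invBranch i x ∈ Ioo (T.a i) (T.b i)) :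
    T.cutMap (T.invBranch i x) = x := (T.exists_invBranch i).choose_spec.2.2.1 x hx

theorem invBranch_cutMap {i : ℕ} {y : ℝ} (hy : y ∈ Ioo (T.a i) (T.b i)) :
    T.invBranch i (T.cutMap y) = y := (T.exists_invBranch i).choose_spec.2.2.2 y hy

theorem deriv_ne_zero {i : ℕ} {x : ℝ} (hx : x ∈ Ioo (T.a i) (T.b i)) : deriv T.τ x ≠ 0 := by
  intro hx0
  have hbig : ∀ y ∈ Ioo (T.a i) (T.b i), deriv T.τ y ≠ 0 → 1 < |deriv T.τ y| := by
    intro y hy hy0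
    have h1 := T.g_le y (T.sub i hy)
    rw [T.g_eq i y hy, div_le_iff₀ (abs_pos.2 hy0)] at h1
    nlinarith [abs_pos.2 hy0, T.β_lt]
  have hord : OrdConnected (deriv T.τ '' Ioo (T.a i) (T.b i)) :=
    ordConnected_Ioo.image_deriv (T.diff i)
  have hzero : EqOn (deriv T.τ) 0 (Ioo (T.a i) (T.b i)) := by
    intro y hy
    by_contra hy0
    have hy1 := hbig y hy hy0
    have hmid : deriv T.τ y / |deriv T.τ y| / 2 ∈ deriv T.τ '' Ioo (T.a i) (T.b i) := by
      have h0 : (0 : ℝ) ∈ deriv T.τ '' Ioo (T.a i) (T.b i) := ⟨x, hx, hx0⟩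
      have hy' : deriv T.τ y ∈ deriv T.τ '' Ioo (T.a i) (T.b i) := ⟨y, hy, rfl⟩
      rcases lt_or_gt_of_ne hy0 with hneg | hpos
      · refine hord.out hy' h0 ?_
        rw [abs_of_neg (by exact hneg)] at hy1 ⊢
        rw [div_neg, div_self hy0]
        constructor <;> linarith
      · refine hord.out h0 hy' ?_
        rw [abs_of_pos (by exact hpos)] at hy1 ⊢
        rw [div_self hy0]
        constructor <;> linarith
    obtain ⟨z, hz, hzeq⟩ := hmid
    have habs : |deriv T.τ z| = 1 / 2 := by
      rw [hzeq, abs_div, abs_div, abs_abs, div_self (by positivity), abs_of_pos two_pos]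
    have := hbig z hz (by rw [← abs_pos, habs]; norm_num)
    linarith
  obtain ⟨z, hz⟩ := exists_between hx.2
  have hz' : z ∈ Ioo (T.a i) (T.b i) := ⟨hx.1.trans hz.1, hz.2⟩
  have heq := isOpen_Ioo.is_const_of_deriv_eq_zero isPreconnected_Ioo
    (fun y hy => (T.diff i y hy).differentiableWithinAt) hzero hx hz'
  have h1 := invBranch_cutMap hx
  rw [cutMap_eq hx, heq, ← cutMap_eq hz', invBranch_cutMap hz'] at h1
  exact hz.1.ne' h1

theorem abs_deriv_mul_g {i : ℕ} {x : ℝ} (hx : x ∈ Ioo (T.a i) (T.b i)) :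
    |deriv T.τ x| * T.g x = 1 := by
  rw [T.g_eq i x hx, mul_one_div_cancel (abs_ne_zero.2 (deriv_ne_zero hx))]

/-! ### The transfer operator -/

variable (T) in
/-- The contribution of the `i`-th branch to the Frobenius–Perron operator. -/
noncomputable def branchTransfer (i : ℕ) (h : ℝ → ℝ) (x : ℝ) : ℝ :=
  T.g (T.invBranch i x) * h (T.invBranch i x)

variable (T) in
/-- A pointwise version of the Frobenius–Perron operator. -/
noncomputable def transfer (h : ℝ → ℝ) (x : ℝ) : ℝ := ∑' i, T.branchTransfer i h x

theorem branchTransfer_eq_zero {i : ℕ} {h : ℝ → ℝ} {x : ℝ}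
    (hx : x ∉ T.cutMap '' Ioo (T.a i) (T.b i)) : T.branchTransfer i h x = 0 := by
  have : T.invBranch i x ∉ Ioo (T.a i) (T.b i) := fun hY => hx ⟨_, hY, cutMap_invBranch hY⟩
  rw [branchTransfer, g_eq_zero_of_mem_Icc (invBranch_mem i x) this, zero_mul]

theorem mul_transfer (k h : ℝ → ℝ) (x : ℝ) :
    k x * T.transfer h x = T.transfer (fun y => k (T.cutMap y) * h y) x := by
  rw [transfer, ← tsum_mul_left]
  refine tsum_congr fun i => ?_
  by_cases hY : T.invBranch i x ∈ Ioo (T.a i) (T.b i)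
  · rw [branchTransfer, branchTransfer, cutMap_invBranch hY]
    ring
  · simp [branchTransfer, g_eq_zero_of_mem_Icc (invBranch_mem i x) hY]

theorem eVariationOn_branchTransfer_le (i : ℕ) (h : ℝ → ℝ) (s : Set ℝ) :
    eVariationOn (T.branchTransfer i h) s ≤
      eVariationOn (fun y => T.g y * h y) (Icc (T.a i) (T.b i)) := by
  rcases T.invBranch_monotone_or_antitone i with hm | hm
  · exact eVariationOn.comp_le_of_monotoneOn (fun y => T.g y * h y) (T.invBranch i)
      (hm.monotoneOn s) fun x _ => invBranch_mem i x
  · exact eVariationOn.comp_le_of_antitoneOn (fun y => T.g y * h y) (T.invBranch i)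
      (hm.antitoneOn s) fun x _ => invBranch_mem i x

theorem eVariationOn_transfer_le (h : ℝ → ℝ) :
    eVariationOn (T.transfer h) (Icc 0 1) ≤
      eVariationOn (fun y => T.g y * h y) (Icc 0 1) := by
  have hsum := tsum_eVariationOn_Icc_le T.lt T.disj Icc_subset (fun y => T.g y * h y)
  rcases eq_or_ne (eVariationOn (fun y => T.g y * h y) (Icc 0 1)) ⊤ with htop | htop
  · rw [htop]
    exact le_top
  have hbound : ∀ x i, ‖T.branchTransfer i h x‖ₑ ≤
      eVariationOn (fun y => T.g y * h y) (Icc (T.a i) (T.b i)) := by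
    intro x i
    have := eVariationOn.edist_le (fun y => T.g y * h y) (invBranch_mem i x)
      (left_mem_Icc.2 (T.lt i).le)
    simp only [g_left, zero_mul, edist_zero_right] at this
    exact this
  refine (eVariationOn_tsum_le fun x _ => ?_).trans
    ((ENNReal.tsum_le_tsum fun i => eVariationOn_branchTransfer_le i h _).trans hsum)
  refine Summable.of_norm (tsum_enorm_ne_top_iff_summable_norm.1 (ne_top_of_le_ne_top htop ?_))
  exact (ENNReal.tsum_le_tsum (hbound x)).trans hsum

theorem integral_branchTransfer (i : ℕ) {h : ℝ → ℝ} (hh : IntegrableOn h (Icc 0 1)) {A : Set ℝ}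
    (hA : MeasurableSet A) :
    IntegrableOn (T.branchTransfer i h) (A ∩ Icc 0 1) ∧
      ∫ x in A ∩ Icc 0 1, T.branchTransfer i h x =
        ∫ x in Ioo (T.a i) (T.b i) ∩ T.cutMap ⁻¹' A, h x := by
  set S := Ioo (T.a i) (T.b i) ∩ T.cutMap ⁻¹' A
  have hS : MeasurableSet S := measurableSet_Ioo.inter (measurable_cutMap hA)
  have hder : ∀ x ∈ S, HasDerivWithinAt T.cutMap (deriv T.τ x) S x := fun x hx =>
    (hasDerivAt_cutMap hx.1).hasDerivWithinAt
  have hinj : InjOn T.cutMap S := fun x hx y hy hxy => by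
    rw [← invBranch_cutMap hx.1, hxy, invBranch_cutMap hy.1]
  have hsub : T.cutMap '' S ⊆ A ∩ Icc 0 1 := by
    rintro _ ⟨x, hx, rfl⟩
    exact ⟨hx.2, cutMap_mem (T.sub i hx.1)⟩
  have hoff : ∀ x ∈ (A ∩ Icc 0 1) \ (T.cutMap '' S), T.branchTransfer i h x = 0 := by
    rintro x ⟨hx, hx'⟩
    refine branchTransfer_eq_zero ?_
    rintro ⟨y, hy, rfl⟩
    exact hx' ⟨y, ⟨hy, hx.1⟩, rfl⟩
  have hpull : EqOn (fun x => |deriv T.τ x| • T.branchTransfer i h (T.cutMap x)) h S := by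
    intro x hx
    simp only [branchTransfer, invBranch_cutMap hx.1, smul_eq_mul]
    rw [← mul_assoc, abs_deriv_mul_g hx.1, one_mul]
  have hmeas : MeasurableSet (A ∩ Icc (0 : ℝ) 1) := hA.inter measurableSet_Icc
  refine ⟨?_, ?_⟩
  · refine IntegrableOn.of_forall_sdiff_eq_zero ?_ hmeas hoff
    rw [integrableOn_image_iff_integrableOn_abs_deriv_smul hS hder hinj,
      integrableOn_congr_fun hpull hS]
    exact hh.mono_set (inter_subset_left.trans (T.sub i))
  · rw [setIntegral_eq_of_subset_of_forall_sdiff_eq_zero hmeas hsub hoff,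
      integral_image_eq_integral_abs_deriv_smul hS hder hinj, setIntegral_congr_fun hS hpull]

theorem norm_branchTransfer (i : ℕ) (h : ℝ → ℝ) (x : ℝ) :
    ‖T.branchTransfer i h x‖ = T.branchTransfer i (fun y => |h y|) x := by
  rw [branchTransfer, branchTransfer, Real.norm_eq_abs, abs_mul, abs_of_nonneg (g_nonneg _)]

theorem dom_ae_eq : T.dom =ᵐ[volume] Icc (0 : ℝ) 1 :=
  (iUnion_subset T.sub).eventuallyLE.antisymm (ae_le_set.2 T.null)

theorem hasSum_integral_branches {h : ℝ → ℝ} (hh : IntegrableOn h (Icc 0 1)) {A : Set ℝ}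
    (hA : MeasurableSet A) :
    HasSum (fun i => ∫ x in Ioo (T.a i) (T.b i) ∩ T.cutMap ⁻¹' A, h x)
      (∫ x in T.cutMap ⁻¹' A ∩ Icc 0 1, h x) := by
  have hU : ⋃ i, Ioo (T.a i) (T.b i) ∩ T.cutMap ⁻¹' A = T.dom ∩ T.cutMap ⁻¹' A :=
    (iUnion_inter _ _).symm
  have hae : (T.cutMap ⁻¹' A ∩ Icc 0 1 : Set ℝ) =ᵐ[volume]
      (⋃ i, Ioo (T.a i) (T.b i) ∩ T.cutMap ⁻¹' A : Set ℝ) := by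
    rw [hU, inter_comm T.dom]
    exact (ae_eq_refl _).inter dom_ae_eq.symm
  rw [setIntegral_congr_set hae]
  refine hasSum_integral_iUnion (fun i => measurableSet_Ioo.inter (measurable_cutMap hA))
    (fun i j hij => (T.disj hij).mono inter_subset_left inter_subset_left) (hh.mono_set ?_)
  exact iUnion_subset fun i => inter_subset_left.trans (T.sub i)

theorem summable_integral_norm_branchTransfer {h : ℝ → ℝ} (hh : IntegrableOn h (Icc 0 1))
    {A : Set ℝ} (hA : MeasurableSet A) :
    Summable fun i => ∫ x in A ∩ Icc 0 1, ‖T.branchTransfer i h x‖ := by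
  have habs : IntegrableOn (fun y => |h y|) (Icc 0 1) := hh.abs
  simp_rw [norm_branchTransfer, fun i => (integral_branchTransfer (T := T) i habs hA).2]
  exact (hasSum_integral_branches habs hA).summable

theorem integrableOn_transfer {h : ℝ → ℝ} (hh : IntegrableOn h (Icc 0 1)) :
    IntegrableOn (T.transfer h) (Icc 0 1) := by
  have hint : ∀ i, IntegrableOn (T.branchTransfer i h) (Icc 0 1) := fun i => by
    simpa using (integral_branchTransfer (T := T) i hh MeasurableSet.univ).1
  have hsum : Summable fun i => ∫ x in Icc 0 1, ‖T.branchTransfer i h x‖ := by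
    simpa using summable_integral_norm_branchTransfer (T := T) hh MeasurableSet.univ
  refine ⟨(AEMeasurable.tsum fun i => (hint i).aemeasurable).aestronglyMeasurable, ?_⟩
  calc ∫⁻ x in Icc 0 1, ‖T.transfer h x‖ₑ
      ≤ ∫⁻ x in Icc 0 1, ∑' i, ‖T.branchTransfer i h x‖ₑ :=
        lintegral_mono fun x => enorm_tsum_le_tsum_enorm
    _ = ∑' i, ∫⁻ x in Icc 0 1, ‖T.branchTransfer i h x‖ₑ :=
        lintegral_tsum fun i => (hint i).aestronglyMeasurable.enorm
    _ = ∑' i, ENNReal.ofReal (∫ x in Icc 0 1, ‖T.branchTransfer i h x‖) :=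
        tsum_congr fun i => (ofReal_integral_norm_eq_lintegral_enorm (hint i)).symm
    _ < ⊤ := hsum.tsum_ofReal_lt_top

theorem integral_transfer {h : ℝ → ℝ} (hh : IntegrableOn h (Icc 0 1)) {A : Set ℝ}
    (hA : MeasurableSet A) :
    ∫ x in A ∩ Icc 0 1, T.transfer h x = ∫ x in T.cutMap ⁻¹' A ∩ Icc 0 1, h x := by
  have h1 := hasSum_integral_of_summable_integral_norm
    (fun i => (integral_branchTransfer (T := T) i hh hA).1)
    (summable_integral_norm_branchTransfer hh hA)
  simp_rw [fun i => (integral_branchTransfer (T := T) i hh hA).2] at h1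
  exact h1.unique (hasSum_integral_branches hh hA)

theorem quasiMeasurePreserving_cutMap : Measure.QuasiMeasurePreserving T.cutMap
    (volume.restrict (Icc 0 1)) (volume.restrict (Icc 0 1)) := by
  refine ⟨measurable_cutMap, Measure.AbsolutelyContinuous.mk fun A hA h0 => ?_⟩
  rw [Measure.restrict_apply hA] at h0
  rw [Measure.map_apply measurable_cutMap hA, Measure.restrict_apply (measurable_cutMap hA)]
  have h1 := integral_transfer (T := T) (h := fun _ => 1) (integrableOn_const (by simp)) hA
  rw [setIntegral_measure_zero _ h0, setIntegral_const, smul_eq_mul, mul_one] at h1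
  refine ((measureReal_eq_zero_iff ?_).1 h1.symm)
  exact measure_ne_top_of_subset inter_subset_right (by simp)

theorem cutMap_ae_eq : T.cutMap =ᵐ[volume.restrict (Icc 0 1)] T.τ := by
  rw [← Measure.restrict_congr_set (dom_ae_eq (T := T))]
  exact indicator_ae_eq_restrict measurableSet_dom

theorem cutMap_iterate_ae_eq (n : ℕ) :
    T.cutMap^[n] =ᵐ[volume.restrict (Icc 0 1)] T.τ^[n] := by
  induction n with
  | zero => rfl
  | succ n ih =>
    filter_upwards [quasiMeasurePreserving_cutMap.ae ih, cutMap_ae_eq (T := T)] with x h1 h2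
    rw [Function.iterate_succ_apply, h1, h2, Function.iterate_succ_apply]

theorem iterate_transfer {f : ℝ → ℝ} (hf : IntegrableOn f (Icc 0 1)) (n : ℕ) :
    IntegrableOn (T.transfer^[n] f) (Icc 0 1) ∧ ∀ A : Set ℝ, MeasurableSet A →
      ∫ x in A ∩ Icc 0 1, T.transfer^[n] f x = ∫ x in T.cutMap^[n] ⁻¹' A ∩ Icc 0 1, f x := by
  induction n with
  | zero => exact ⟨hf, fun A _ => rfl⟩
  | succ n ih =>
    simp only [Function.iterate_succ_apply']
    refine ⟨integrableOn_transfer ih.1, fun A hA => ?_⟩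
    rw [integral_transfer ih.1 hA, ih.2 _ (measurable_cutMap hA), Function.iterate_succ',
      preimage_comp]

theorem transfer_iterate_ae_eq {f Pf : ℝ → ℝ} (hf : IntegrableOn f (Icc 0 1))
    (hPf : IntegrableOn Pf (Icc 0 1)) (n : ℕ)
    (h : ∀ A : Set ℝ, MeasurableSet A → A ⊆ Icc (0 : ℝ) 1 →
      ∫ x in A, Pf x = ∫ x in T.τ^[n] ⁻¹' A ∩ Icc (0 : ℝ) 1, f x) :
    T.transfer^[n] f =ᵐ[volume.restrict (Icc 0 1)] Pf := by
  obtain ⟨hint, hA⟩ := T.iterate_transfer hf n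
  refine Integrable.ae_eq_of_forall_setIntegral_eq _ _ hint hPf fun A hAm _ => ?_
  have hAI : MeasurableSet (A ∩ Icc (0 : ℝ) 1) := hAm.inter measurableSet_Icc
  have hset : (T.cutMap^[n] ⁻¹' (A ∩ Icc 0 1) ∩ Icc 0 1 : Set ℝ) =ᵐ[volume]
      (T.τ^[n] ⁻¹' (A ∩ Icc 0 1) ∩ Icc 0 1 : Set ℝ) := by
    have := (ae_restrict_iff' measurableSet_Icc).1 (T.cutMap_iterate_ae_eq n)
    filter_upwards [this] with x hx
    refine propext ⟨fun hx' => ⟨?_, hx'.2⟩, fun hx' => ⟨?_, hx'.2⟩⟩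
    · have := hx'.1
      rwa [mem_preimage, hx hx'.2] at this
    · have := hx'.1
      rwa [mem_preimage, ← hx hx'.2] at this
  rw [Measure.restrict_restrict hAm, h _ hAI inter_subset_right, ← setIntegral_congr_set hset,
    ← hA _ hAI, inter_assoc, inter_self]

/-! ### Weights of the iterates -/

variable (T) in
/-- The weight `g · (g ∘ τ) ⋯ (g ∘ τⁿ⁻¹)` of the `n`-th iterate. -/
noncomputable def weight : ℕ → ℝ → ℝ
  | 0, _ => 1
  | n + 1, x => T.g x * weight n (T.cutMap x)

theorem weight_nonneg (n : ℕ) (x : ℝ) : 0 ≤ T.weight n x := by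
  induction n generalizing x with
  | zero => exact zero_le_one
  | succ n ih => exact mul_nonneg (g_nonneg x) (ih _)

theorem weight_le (n : ℕ) {x : ℝ} (hx : x ∈ Icc (0 : ℝ) 1) : T.weight n x ≤ T.β ^ n := by
  induction n generalizing x with
  | zero => simp [weight]
  | succ n ih =>
    rw [pow_succ', weight]
    exact mul_le_mul (T.g_le x hx) (ih (cutMap_mem hx)) (weight_nonneg _ _) β_nonneg

theorem enorm_weight_le_one (n : ℕ) {x : ℝ} (hx : x ∈ Icc (0 : ℝ) 1) : ‖T.weight n x‖ₑ ≤ 1 := by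
  rw [Real.enorm_eq_ofReal (weight_nonneg n x), ENNReal.ofReal_le_one]
  exact (weight_le n hx).trans (pow_le_one₀ β_nonneg T.β_lt.le)

theorem boundedVariationOn_g_mul_comp {h : ℝ → ℝ} (hv : BoundedVariationOn h (Icc 0 1))
    (hb : ∀ x ∈ Icc (0 : ℝ) 1, ‖h x‖ₑ ≤ 1) :
    BoundedVariationOn (fun x => T.g x * h (T.cutMap x)) (Icc 0 1) := by
  have hbranch : ∀ i, eVariationOn (fun x => T.g x * h (T.cutMap x)) (Icc (T.a i) (T.b i)) ≤
      eVariationOn T.g (Icc (T.a i) (T.b i)) * (eVariationOn h (Icc 0 1) + 1) := by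
    intro i
    obtain ⟨σ, -, heq, hmaps, hmono⟩ := T.exists_strictMonoOn_or_strictAntiOn i
    have hcongr : EqOn (fun x => T.g x * h (T.cutMap x)) (fun x => T.g x * (h ∘ σ) x)
        (Icc (T.a i) (T.b i)) := by
      intro x hx
      by_cases hx' : x ∈ Ioo (T.a i) (T.b i)
      · simp only [Function.comp_apply, cutMap_eq hx', heq hx']
      · simp only [g_eq_zero_of_mem_Icc hx hx', zero_mul]
    have hcomp : eVariationOn (h ∘ σ) (Icc (T.a i) (T.b i)) ≤ eVariationOn h (Icc 0 1) := by
      rcases hmono with hm | hm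
      · exact eVariationOn.comp_le_of_monotoneOn h σ hm.monotoneOn hmaps
      · exact eVariationOn.comp_le_of_antitoneOn h σ hm.antitoneOn hmaps
    have hg : ∀ x ∈ Icc (T.a i) (T.b i), ‖T.g x‖ₑ ≤ eVariationOn T.g (Icc (T.a i) (T.b i)) := by
      intro x hx
      have := eVariationOn.edist_le T.g hx (left_mem_Icc.2 (T.lt i).le)
      rwa [g_left, edist_zero_right] at this
    rw [eVariationOn.congr hcongr, mul_add, mul_comm _ 1]
    refine (eVariationOn_fun_mul_le hg fun x hx => hb _ (hmaps hx)).trans ?_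
    gcongr
    exact hcomp
  refine ne_top_of_le_ne_top (b := eVariationOn T.g (Icc 0 1) * (eVariationOn h (Icc 0 1) + 1))
    (ENNReal.mul_ne_top T.g_bv (ENNReal.add_ne_top.2 ⟨hv, ENNReal.one_ne_top⟩)) ?_
  calc eVariationOn (fun x => T.g x * h (T.cutMap x)) (Icc 0 1)
      ≤ ∑' i, eVariationOn (fun x => T.g x * h (T.cutMap x)) (Icc (T.a i) (T.b i)) :=
        eVariationOn_le_tsum_Icc (by simp [g_left]) (by simp [g_right])
          (fun x hx => by simp [T.g_zero x hx]) _
    _ ≤ ∑' i, eVariationOn T.g (Icc (T.a i) (T.b i)) * (eVariationOn h (Icc 0 1) + 1) :=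
        ENNReal.tsum_le_tsum hbranch
    _ = (∑' i, eVariationOn T.g (Icc (T.a i) (T.b i))) * (eVariationOn h (Icc 0 1) + 1) :=
        ENNReal.tsum_mul_right
    _ ≤ _ := by
        gcongr
        exact tsum_eVariationOn_Icc_le T.lt T.disj Icc_subset T.g

theorem boundedVariationOn_weight (n : ℕ) : BoundedVariationOn (T.weight n) (Icc 0 1) := by
  induction n with
  | zero =>
    have : eVariationOn (T.weight 0) (Icc 0 1) = 0 :=
      eVariationOn.constant_on (by rintro _ ⟨x, _, rfl⟩ _ ⟨y, _, rfl⟩; rfl)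
    simp [BoundedVariationOn, this]
  | succ n ih => exact boundedVariationOn_g_mul_comp ih fun x hx => enorm_weight_le_one n hx

theorem eVariationOn_iterate_transfer_le (n : ℕ) (f : ℝ → ℝ) :
    eVariationOn (T.transfer^[n] f) (Icc 0 1) ≤
      eVariationOn (fun x => T.weight n x * f x) (Icc 0 1) := by
  induction n generalizing f with
  | zero => simp [weight]
  | succ n ih =>
    refine (ih (T.transfer f)).trans ?_
    simp_rw [mul_transfer]
    refine (eVariationOn_transfer_le _).trans_eq ?_
    simp only [weight, mul_assoc]

end PET

/-- Theorem 2.2.3, after Rychlik. Let `τ ∈ 𝒯_E`. Then for every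
sufficiently large `n ∈ ℕ` there exists `Bₙ > 0` such that for every `f ∈ BV_I` and every
version `Pf` of `P_{τ}ⁿ f = P_{τⁿ} f` (characterized by
`∫_A Pf dm = ∫_{(τⁿ)⁻¹ A} f dm`), `Pf` agrees a.e. with a function `Pf'` satisfying
`var_I Pf' ≤ (1/2)·var_I f + Bₙ·‖f‖₁`. -/
theorem lasotaYorke_variation_inequality (T : PET) :
    ∃ N : ℕ, ∀ n ≥ N, ∃ B : ℝ, 0 < B ∧
      ∀ f : ℝ → ℝ, MeasureTheory.IntegrableOn f (Set.Icc (0:ℝ) 1) →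
        BoundedVariationOn f (Set.Icc (0:ℝ) 1) →
      ∀ Pf : ℝ → ℝ, MeasureTheory.IntegrableOn Pf (Set.Icc (0:ℝ) 1) →
        (∀ A : Set ℝ, MeasurableSet A → A ⊆ Set.Icc (0:ℝ) 1 →
          ∫ x in A, Pf x = ∫ x in T.τ^[n] ⁻¹' A ∩ Set.Icc (0:ℝ) 1, f x) →
        ∃ Pf' : ℝ → ℝ, Pf' =ᵐ[volume.restrict (Set.Icc (0:ℝ) 1)] Pf ∧
          eVariationOn Pf' (Set.Icc (0:ℝ) 1) ≤
            (1/2) * eVariationOn f (Set.Icc (0:ℝ) 1) +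
            ENNReal.ofReal (B * ∫ x in Set.Icc (0:ℝ) 1, |f x|) := by
  have hlim := tendsto_pow_atTop_nhds_zero_of_lt_one T.β_nonneg T.β_lt
  obtain ⟨N, hN⟩ := eventually_atTop.1
    (hlim.eventually (eventually_le_nhds (show (0 : ℝ) < 1 / 6 by norm_num)))
  refine ⟨N, fun n hn => ?_⟩
  obtain ⟨B, hB, H⟩ := MulVariationBound.of_boundedVariationOn (c := 1 / 6) (by norm_num)
    zero_le_one (fun x _ => T.weight_nonneg n x) (fun x hx => (T.weight_le n hx).trans (hN n hn))
    (T.boundedVariationOn_weight n)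
  refine ⟨B, hB, fun f hf hfv Pf hPf hP =>
    ⟨T.transfer^[n] f, T.transfer_iterate_ae_eq hf hPf n hP, ?_⟩⟩
  have hhalf : ENNReal.ofReal (3 * (1 / 6)) = 1 / 2 := by
    rw [show (3 * (1 / 6) : ℝ) = 1 / 2 by norm_num, ENNReal.ofReal_div_of_pos two_pos]
    simp
  exact (T.eVariationOn_iterate_transfer_le n f).trans (hhalf ▸ H f hf hfv)
end
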